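/- Let β, ε, δ ∈ (0,1), let n, t, Δ be integers and w ≥ 1 a real with Δ < t ≤ n, and let X ⊆ ℝ be a finite set. If there exists an (ε,δ)-differentially private algorithm that solves the 1-cluster problem (X, n, t) with parameters (Δ, w) and error probability β, then for every integer m ≥ n + 8^{log*(4w)}·(144·log*(4w)/ε)·log₂(12·log*(4w)/(βδ)) there exists a (2ε, 2δ)-differentially private algorithm that solves the interior point problem on X with error probability 2β and sample complexity m. -/

import Mathlib

open MeasureTheory
open scoped NNReal ENNReal

/-- Iterated logarithm (base 2). -/
noncomputable def logStar (x : ℝ) : ℕ := sInf {k : ℕ | (Real.logb 2)^[k] x ≤ 1}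

/-- Number of entries of `S` inside the closed interval `[a, b]`. -/
noncomputable def intervalCount {n : ℕ} (S : Fin n → ℝ) (a b : ℝ) : ℕ :=
  Nat.card {i : Fin n // a ≤ S i ∧ S i ≤ b}

/-- The minimal radius of a closed interval centered at a point of `X`
containing at least `t` entries of `S`. -/
noncomputable def rOpt1 {n : ℕ} (X : Set ℝ) (S : Fin n → ℝ) (t : ℕ) : ℝ :=
  sInf {r : ℝ | 0 ≤ r ∧ ∃ c ∈ X, t ≤ intervalCount S (c - r) (c + r)}

/-- `(ε,δ)`-differential privacy for databases whose entries all lie in `A`. -/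
def IsDPOn {U Ω : Type*} [MeasurableSpace Ω] {n : ℕ} (A : Set U)
    (M : (Fin n → U) → Measure Ω) (ε δ : ℝ) : Prop :=
  ∀ S S' : Fin n → U, (∀ i, S i ∈ A) → (∀ i, S' i ∈ A) →
    (∃ i₀, S i₀ ≠ S' i₀ ∧ ∀ j, j ≠ i₀ → S j = S' j) →
    ∀ T : Set Ω, MeasurableSet T →
      M S T ≤ ENNReal.ofReal (Real.exp ε) * M S' T + ENNReal.ofReal δ

/-- `M` solves the 1-cluster problem `(X, n, t)` with parameters `(Δ, w)` and error
probability `β`. -/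
def Solves1Cluster {n : ℕ} (X : Set ℝ) (M : (Fin n → ℝ) → Measure (ℝ × ℝ≥0))
    (t : ℕ) (Δ : ℤ) (w β : ℝ) : Prop :=
  ∀ S : Fin n → ℝ, (∀ i, S i ∈ X) →
    ENNReal.ofReal (1 - β) ≤
      M S {cr : ℝ × ℝ≥0 |
        (t : ℝ) - (Δ : ℝ) ≤ (intervalCount S (cr.1 - (cr.2 : ℝ)) (cr.1 + (cr.2 : ℝ)) : ℝ) ∧
        (cr.2 : ℝ) ≤ w * rOpt1 X S t}

/-- `A` solves the interior point problem on `X` with error probability `β`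
(and sample complexity `m`). -/
def SolvesIntPoint {m : ℕ} (X : Set ℝ) (A : (Fin m → ℝ) → Measure ℝ) (β : ℝ) : Prop :=
  ∀ D : Fin m → ℝ, (∀ i, D i ∈ X) →
    ENNReal.ofReal (1 - β) ≤ A D {y : ℝ | sInf (Set.range D) ≤ y ∧ y ≤ sSup (Set.range D)}

/-- `(ε,δ)`-indistinguishability (one direction) of two measures. -/
def Indist {Ω : Type*} [MeasurableSpace Ω] (ε δ : ℝ) (μ ν : Measure Ω) : Prop :=
  ∀ T : Set Ω, MeasurableSet T →
    μ T ≤ ENNReal.ofReal (Real.exp ε) * ν T + ENNReal.ofReal δ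

theorem Indist.refl {Ω : Type*} [MeasurableSpace Ω] {ε δ : ℝ} (hε : 0 ≤ ε) (μ : Measure Ω) :
    Indist ε δ μ μ := fun _ _ =>
  (le_mul_of_one_le_left zero_le (ENNReal.one_le_ofReal.2 (Real.one_le_exp hε))).trans le_self_add

theorem lintegral_eq_setLIntegral_meas_le {Ω : Type*} [MeasurableSpace Ω] (μ : Measure Ω)
    {g : Ω → ℝ≥0∞} (hg : Measurable g) (hg1 : ∀ x, g x ≤ 1) :
    ∫⁻ x, g x ∂μ = ∫⁻ t in Set.Ioc (0 : ℝ) 1, μ {x | t ≤ (g x).toReal} := by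
  have hfin : ∀ x, g x ≠ ⊤ := fun x => ne_top_of_le_ne_top ENNReal.one_ne_top (hg1 x)
  have h1 : ∫⁻ x, g x ∂μ = ∫⁻ x, ENNReal.ofReal (g x).toReal ∂μ := by
    refine lintegral_congr fun x => ?_
    rw [ENNReal.ofReal_toReal (hfin x)]
  rw [h1, lintegral_eq_lintegral_meas_le μ (Filter.Eventually.of_forall fun x =>
    ENNReal.toReal_nonneg) hg.ennreal_toReal.aemeasurable]
  rw [← Set.Ioc_union_Ioi_eq_Ioi (zero_le_one' ℝ), lintegral_union measurableSet_Ioi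
    (Set.Ioc_disjoint_Ioi le_rfl)]
  refine (congrArg _ ?_).trans (add_zero _)
  refine (setLIntegral_congr_fun measurableSet_Ioi fun t ht1 => ?_).trans lintegral_zero
  have : {x | t ≤ (g x).toReal} = ∅ := by
    ext x
    simp only [Set.mem_ofPred_eq, Set.mem_empty_iff_false, iff_false, not_le]
    refine lt_of_le_of_lt ?_ ht1
    exact ENNReal.toReal_le_of_le_ofReal zero_le_one (by simpa using hg1 x)
  simp only [this, measure_empty]

theorem Indist.lintegral_le {Ω : Type*} [MeasurableSpace Ω] {ε δ : ℝ} {μ ν : Measure Ω}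
    (h : Indist ε δ μ ν) {g : Ω → ℝ≥0∞} (hg : Measurable g) (hg1 : ∀ x, g x ≤ 1) :
    ∫⁻ x, g x ∂μ ≤ ENNReal.ofReal (Real.exp ε) * ∫⁻ x, g x ∂ν + ENNReal.ofReal δ := by
  rw [lintegral_eq_setLIntegral_meas_le μ hg hg1, lintegral_eq_setLIntegral_meas_le ν hg hg1,
    ← lintegral_const_mul' _ _ ENNReal.ofReal_ne_top]
  calc _ ≤ ∫⁻ t in Set.Ioc (0 : ℝ) 1,
        (ENNReal.ofReal (Real.exp ε) * ν {x | t ≤ (g x).toReal} + ENNReal.ofReal δ) :=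
        lintegral_mono fun t => h _ (measurableSet_le measurable_const hg.ennreal_toReal)
    _ = _ := by
        rw [lintegral_add_right _ measurable_const]
        simp

/-- Adaptive composition, stated for test functions. -/
theorem Indist.lintegral_comp_le {Ω : Type*} [MeasurableSpace Ω] {ε₁ δ₁ ε₂ δ₂ : ℝ}
    (hδ₁ : 0 ≤ δ₁) (hδ₂ : 0 ≤ δ₂)
    {μ ν : Measure Ω} [IsProbabilityMeasure μ] (h : Indist ε₁ δ₁ μ ν) {g g' : Ω → ℝ≥0∞}
    (hg' : Measurable g') (hg1 : ∀ x, g x ≤ 1)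
    (hgg' : ∀ x, g x ≤ ENNReal.ofReal (Real.exp ε₂) * g' x + ENNReal.ofReal δ₂) :
    ∫⁻ x, g x ∂μ ≤
      ENNReal.ofReal (Real.exp (ε₁ + ε₂)) * ∫⁻ x, g' x ∂ν + ENNReal.ofReal (δ₁ + δ₂) := by
  have hm : Measurable fun x => min 1 (ENNReal.ofReal (Real.exp ε₂) * g' x) :=
    measurable_const.min (hg'.const_mul _)
  have hle : ∀ x, g x ≤ min 1 (ENNReal.ofReal (Real.exp ε₂) * g' x) + ENNReal.ofReal δ₂ := by
    intro x
    rcases min_cases 1 (ENNReal.ofReal (Real.exp ε₂) * g' x) with ⟨h1, _⟩ | ⟨h1, _⟩ <;> rw [h1]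
    · exact (hg1 x).trans le_self_add
    · exact hgg' x
  calc ∫⁻ x, g x ∂μ
      ≤ ∫⁻ x, (min 1 (ENNReal.ofReal (Real.exp ε₂) * g' x) + ENNReal.ofReal δ₂) ∂μ :=
        lintegral_mono hle
    _ = ∫⁻ x, min 1 (ENNReal.ofReal (Real.exp ε₂) * g' x) ∂μ + ENNReal.ofReal δ₂ := by
        rw [lintegral_add_right _ measurable_const]; simp
    _ ≤ (ENNReal.ofReal (Real.exp ε₁) *
          ∫⁻ x, min 1 (ENNReal.ofReal (Real.exp ε₂) * g' x) ∂ν + ENNReal.ofReal δ₁)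
          + ENNReal.ofReal δ₂ := by
        gcongr
        exact h.lintegral_le hm fun x => min_le_left _ _
    _ ≤ (ENNReal.ofReal (Real.exp ε₁) * (ENNReal.ofReal (Real.exp ε₂) * ∫⁻ x, g' x ∂ν)
          + ENNReal.ofReal δ₁) + ENNReal.ofReal δ₂ := by
        gcongr
        rw [← lintegral_const_mul _ hg']
        exact lintegral_mono fun x => min_le_right _ _
    _ = _ := by
        rw [Real.exp_add, ENNReal.ofReal_mul (Real.exp_pos _).le, ENNReal.ofReal_add hδ₁ hδ₂,
          mul_assoc, add_assoc]

/-- The exponential mechanism with scores `s`, followed by the map `out`. -/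
noncomputable def expMech {O : Type*} [Fintype O] (s : O → ℝ) (out : O → ℕ) : Measure ℕ :=
  ∑ o, ENNReal.ofReal (Real.exp (s o) / ∑ o', Real.exp (s o')) • Measure.dirac (out o)

open Classical in
theorem expMech_apply {O : Type*} [Fintype O] (s : O → ℝ) (out : O → ℕ) (T : Set ℕ) :
    expMech s out T =
      ENNReal.ofReal ((∑ o with out o ∈ T, Real.exp (s o)) / ∑ o, Real.exp (s o)) := by
  have hZ : 0 ≤ ∑ o, Real.exp (s o) := Finset.sum_nonneg fun o _ => (Real.exp_pos _).le
  rw [Finset.sum_div, ENNReal.ofReal_sum_of_nonneg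
    (fun o _ => div_nonneg (Real.exp_pos _).le hZ), Finset.sum_filter, expMech,
    Measure.finsetSum_apply]
  refine Finset.sum_congr rfl fun o _ => ?_
  by_cases ho : out o ∈ T <;> simp [ho]

instance {O : Type*} [Fintype O] [Nonempty O] (s : O → ℝ) (out : O → ℕ) :
    IsProbabilityMeasure (expMech s out) := by
  classical
  refine ⟨?_⟩
  have hZ : 0 < ∑ o, Real.exp (s o) :=
    Finset.sum_pos (fun o _ => Real.exp_pos _) Finset.univ_nonempty
  rw [expMech_apply]
  simp [div_self hZ.ne']

open Classical in
theorem expMech_indist {O : Type*} [Fintype O] [Nonempty O] {s s' : O → ℝ} {out out' : O → ℕ}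
    {ε δ : ℝ} (hδ : 0 ≤ δ) (hs : ∀ o, |s o - s' o| ≤ ε / 2) (Bad : O → Prop)
    (hout : ∀ o, ¬ Bad o → out o = out' o)
    (hbad : ∑ o with Bad o, Real.exp (s o) ≤ δ * ∑ o, Real.exp (s o)) :
    Indist ε δ (expMech s out) (expMech s' out') := by
  intro T _
  have hZ : 0 < ∑ o, Real.exp (s o) :=
    Finset.sum_pos (fun o _ => Real.exp_pos _) Finset.univ_nonempty
  have hZ' : 0 < ∑ o, Real.exp (s' o) :=
    Finset.sum_pos (fun o _ => Real.exp_pos _) Finset.univ_nonempty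
  have hN' : 0 ≤ ∑ o with out' o ∈ T, Real.exp (s' o) :=
    Finset.sum_nonneg fun o _ => (Real.exp_pos _).le
  rw [expMech_apply, expMech_apply, ← ENNReal.ofReal_mul (Real.exp_pos _).le,
    ← ENNReal.ofReal_add (mul_nonneg (Real.exp_pos _).le (div_nonneg hN' hZ'.le)) hδ]
  refine ENNReal.ofReal_le_ofReal ?_
  have h1 : ∑ o with out o ∈ T, Real.exp (s o) ≤
      ∑ o with out' o ∈ T, Real.exp (s o) + ∑ o with Bad o, Real.exp (s o) := by
    calc _ ≤ ∑ o ∈ (Finset.univ.filter fun o => out' o ∈ T) ∪ (Finset.univ.filter fun o => Bad o),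
          Real.exp (s o) := by
          refine Finset.sum_le_sum_of_subset_of_nonneg ?_ fun o _ _ => (Real.exp_pos _).le
          intro o ho
          simp only [Finset.mem_filter, Finset.mem_univ, true_and, Finset.mem_union] at ho ⊢
          by_cases hb : Bad o
          · exact Or.inr hb
          · exact Or.inl (hout o hb ▸ ho)
      _ ≤ _ := by
          rw [← Finset.sum_union_inter]
          exact le_add_of_nonneg_right (Finset.sum_nonneg fun o _ => (Real.exp_pos _).le)
  have h2 : ∑ o with out' o ∈ T, Real.exp (s o) ≤
      Real.exp (ε / 2) * ∑ o with out' o ∈ T, Real.exp (s' o) := by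
    rw [Finset.mul_sum]
    refine Finset.sum_le_sum fun o _ => ?_
    rw [← Real.exp_add, Real.exp_le_exp]
    linarith [(abs_le.1 (hs o)).2]
  have h3 : ∑ o, Real.exp (s' o) ≤ Real.exp (ε / 2) * ∑ o, Real.exp (s o) := by
    rw [Finset.mul_sum]
    refine Finset.sum_le_sum fun o _ => ?_
    rw [← Real.exp_add, Real.exp_le_exp]
    linarith [(abs_le.1 (hs o)).1]
  have he : Real.exp ε = Real.exp (ε / 2) * Real.exp (ε / 2) := by
    rw [← Real.exp_add]; congr 1; ring
  rw [div_le_iff₀ hZ, add_mul, he]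
  have h4 : Real.exp (ε / 2) * ∑ o with out' o ∈ T, Real.exp (s' o) ≤
      Real.exp (ε / 2) * Real.exp (ε / 2) *
        ((∑ o with out' o ∈ T, Real.exp (s' o)) / ∑ o, Real.exp (s' o)) *
          ∑ o, Real.exp (s o) := by
    set A := ∑ o with out' o ∈ T, Real.exp (s' o)
    set Z := ∑ o, Real.exp (s o)
    set Z' := ∑ o, Real.exp (s' o)
    have : Real.exp (ε / 2) * Real.exp (ε / 2) * (A / Z') * Z =
        Real.exp (ε / 2) * A * ((Real.exp (ε / 2) * Z) / Z') := by ring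
    rw [this]
    refine le_mul_of_one_le_right (mul_nonneg (Real.exp_pos _).le hN') ?_
    rwa [one_le_div hZ']
  linarith

theorem expMech_fail_le {O : Type*} [Fintype O] {s : O → ℝ} {out : O → ℕ}
    {lo hi β : ℝ} {T : Set ℕ} (o₀ : O) (h₀ : hi ≤ s o₀) (hT : ∀ o, out o ∈ T → s o ≤ lo)
    (hβ : Fintype.card O * Real.exp (lo - hi) ≤ β) :
    expMech s out T ≤ ENNReal.ofReal β := by
  classical
  rw [expMech_apply]
  refine ENNReal.ofReal_le_ofReal ?_
  have hZ : Real.exp hi ≤ ∑ o, Real.exp (s o) :=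
    (Real.exp_le_exp.2 h₀).trans
      (Finset.single_le_sum (f := fun o => Real.exp (s o)) (fun o _ => (Real.exp_pos _).le)
        (Finset.mem_univ o₀))
  have hβ0 : 0 ≤ β := le_trans (by positivity) hβ
  rw [div_le_iff₀ (lt_of_lt_of_le (Real.exp_pos _) hZ)]
  calc ∑ o with out o ∈ T, Real.exp (s o) ≤ ∑ o with out o ∈ T, Real.exp lo := by
        refine Finset.sum_le_sum fun o ho => Real.exp_le_exp.2 (hT o ?_)
        simpa using ho
    _ ≤ ∑ _o : O, Real.exp lo :=
        Finset.sum_le_sum_of_subset_of_nonneg (Finset.filter_subset _ _)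
          fun o _ _ => (Real.exp_pos _).le
    _ = Fintype.card O * Real.exp (lo - hi) * Real.exp hi := by
        rw [mul_assoc, ← Real.exp_add]; simp
    _ ≤ β * ∑ o, Real.exp (s o) := mul_le_mul hβ hZ (Real.exp_pos _).le hβ0

/-- The maximum of `f` on `{0, …, N}`. -/
noncomputable def rangeMax (N : ℕ) (f : ℕ → ℝ) : ℝ :=
  (Finset.range (N + 1)).sup' Finset.nonempty_range_add_one f

theorem le_rangeMax {N : ℕ} (f : ℕ → ℝ) {i : ℕ} (hi : i ≤ N) : f i ≤ rangeMax N f :=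
  Finset.le_sup' f (Finset.mem_range.2 (Nat.lt_succ_of_le hi))

theorem rangeMax_le {N : ℕ} {f : ℕ → ℝ} {a : ℝ} (h : ∀ i ≤ N, f i ≤ a) : rangeMax N f ≤ a :=
  Finset.sup'_le _ _ fun i hi => h i (Nat.le_of_lt_succ (Finset.mem_range.1 hi))

theorem exists_eq_rangeMax (N : ℕ) (f : ℕ → ℝ) : ∃ i ≤ N, f i = rangeMax N f := by
  obtain ⟨i, hi, h⟩ := Finset.exists_mem_eq_sup' (Finset.nonempty_range_add_one (n := N)) f
  exact ⟨i, Nat.le_of_lt_succ (Finset.mem_range.1 hi), h.symm⟩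

theorem abs_rangeMax_sub_le {N : ℕ} {f f' : ℕ → ℝ} (h : ∀ i, |f i - f' i| ≤ 1) :
    |rangeMax N f - rangeMax N f'| ≤ 1 := by
  rw [abs_le]
  constructor
  · have : rangeMax N f' ≤ rangeMax N f + 1 := rangeMax_le fun i hi => by
      linarith [(abs_le.1 (h i)).1, le_rangeMax f hi]
    linarith
  · have : rangeMax N f ≤ rangeMax N f' + 1 := rangeMax_le fun i hi => by
      linarith [(abs_le.1 (h i)).2, le_rangeMax f' hi]
    linarith

/-- Nonnegative quasi-concave score functions supported in `{0, …, N - 1}`. -/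
structure IsScore (N : ℕ) (f : ℕ → ℝ) : Prop where
  nonneg : ∀ i, 0 ≤ f i
  eq_zero : ∀ i, N ≤ i → f i = 0
  quasi : ∀ i j k, i ≤ j → j ≤ k → min (f i) (f k) ≤ f j

theorem IsScore.mono {N N' : ℕ} {f : ℕ → ℝ} (h : IsScore N f) (hN : N ≤ N') : IsScore N' f :=
  ⟨h.nonneg, fun i hi => h.eq_zero i (hN.trans hi), h.quasi⟩

theorem IsScore.lt_of_pos {N : ℕ} {f : ℕ → ℝ} (h : IsScore N f) {i : ℕ} (hi : 0 < f i) :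
    i < N := by
  by_contra hcon
  exact hi.ne' (h.eq_zero i (not_lt.1 hcon))

theorem IsScore.apply_le_rangeMax {N : ℕ} {f : ℕ → ℝ} (h : IsScore N f) (i : ℕ) :
    f i ≤ rangeMax N f := by
  rcases le_total i N with hi | hi
  · exact le_rangeMax f hi
  · rw [h.eq_zero i hi]
    exact (h.nonneg 0).trans (le_rangeMax f (Nat.zero_le N))

/-- A private mechanism which, given a score function with a value at least `r`, returns a point
of score at least `g` up to failure probability `β`. -/
structure IsSelector (N : ℕ) (g r ε δ β : ℝ) (P : (ℕ → ℝ) → Measure ℕ) : Prop where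
  isProb : ∀ f, IsProbabilityMeasure (P f)
  indist : ∀ f f' : ℕ → ℝ, (∀ i, |f i - f' i| ≤ 1) → Indist ε δ (P f) (P f')
  fail_le : ∀ f, IsScore N f → (∃ i, r ≤ f i) → P f {i | f i < g} ≤ ENNReal.ofReal β

theorem exists_isSelector_two {g a ε δ β : ℝ} (hg : 0 ≤ g) (ha : 0 < a) (hε : 0 < ε)
    (hδ : 0 ≤ δ) (hβ : 11 * Real.exp (-(ε / 4 * a)) ≤ β) :
    ∃ P, IsSelector 2 g (g + a) ε δ β P := by
  refine ⟨fun f => expMech (fun o : Fin 2 => ε / 2 * f o) (fun o => o), ?_, ?_, ?_⟩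
  · intro f; infer_instance
  · intro f f' hff'
    refine expMech_indist hδ (fun o => ?_) (fun _ => False) (fun _ _ => rfl) ?_
    · rw [← mul_sub, abs_mul, abs_of_pos (half_pos hε)]
      exact mul_le_of_le_one_right (half_pos hε).le (hff' o)
    · simpa using mul_nonneg hδ (by positivity)
  · rintro f hf ⟨i, hi⟩
    have hi2 : i < 2 := hf.lt_of_pos (by linarith)
    refine expMech_fail_le (lo := ε / 2 * g) (hi := ε / 2 * (g + a)) ⟨i, hi2⟩ ?_ ?_ ?_
    · exact mul_le_mul_of_nonneg_left hi (half_pos hε).le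
    · intro o ho
      exact mul_le_mul_of_nonneg_left (le_of_lt ho) (half_pos hε).le
    · refine le_trans ?_ hβ
      have h1 : Real.exp (ε / 2 * g - ε / 2 * (g + a)) ≤ Real.exp (-(ε / 4 * a)) := by
        rw [Real.exp_le_exp]; nlinarith [mul_pos hε ha]
      have h2 := Real.exp_pos (-(ε / 4 * a))
      simp only [Fintype.card_fin, Nat.cast_ofNat]
      linarith

/-- The offset, in units of the cell size, of the two partitions into blocks. -/
def blockOffset (b : Bool) : ℕ := if b then 2 else 0

/-- Index of the block containing `y`; blocks consist of four cells of size `K`. -/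
def blockIndex (K : ℕ) (b : Bool) (y : ℕ) : ℕ := (y / K + blockOffset b) / 4

/-- A maximizer of `f` on `{0, …, N}`. -/
noncomputable def argMax (N : ℕ) (f : ℕ → ℝ) : ℕ := (exists_eq_rangeMax N f).choose

theorem apply_argMax (N : ℕ) (f : ℕ → ℝ) : f (argMax N f) = rangeMax N f :=
  (exists_eq_rangeMax N f).choose_spec.2

theorem argMax_le (N : ℕ) (f : ℕ → ℝ) : argMax N f ≤ N :=
  (exists_eq_rangeMax N f).choose_spec.1

/-- The difference of the maximum of `f` and its maximum off block `i`. -/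
noncomputable def blockGap (N K : ℕ) (b : Bool) (f : ℕ → ℝ) (i : ℕ) : ℝ :=
  rangeMax N f - rangeMax N fun y => if blockIndex K b y = i then 0 else f y

theorem abs_blockGap_sub_le {N K : ℕ} {b : Bool} {f f' : ℕ → ℝ} (h : ∀ i, |f i - f' i| ≤ 1)
    (i : ℕ) : |blockGap N K b f i - blockGap N K b f' i| ≤ 2 := by
  have h1 := abs_le.1 (abs_rangeMax_sub_le (N := N) h)
  have h2 := abs_le.1 (abs_rangeMax_sub_le (N := N)
    (f := fun y => if blockIndex K b y = i then 0 else f y)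
    (f' := fun y => if blockIndex K b y = i then 0 else f' y) fun y => by
      by_cases hy : blockIndex K b y = i <;> simp [hy, h y])
  rw [abs_le, blockGap, blockGap]
  constructor <;> linarith [h1.1, h1.2, h2.1, h2.2]

theorem blockIndex_argMax_of_blockGap_pos {N K : ℕ} {b : Bool} {f : ℕ → ℝ} {i : ℕ}
    (h : 0 < blockGap N K b f i) : blockIndex K b (argMax N f) = i := by
  by_contra hne
  have := le_rangeMax (fun y => if blockIndex K b y = i then 0 else f y) (argMax_le N f)
  simp only [hne, if_false, apply_argMax] at this
  rw [blockGap] at h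
  linarith

/-- The block of the maximizer. -/
noncomputable def topBlock (N K : ℕ) (b : Bool) (f : ℕ → ℝ) : ℕ := blockIndex K b (argMax N f)

theorem topBlock_eq_of_two_lt {N K : ℕ} {b : Bool} {f f' : ℕ → ℝ} (h : ∀ i, |f i - f' i| ≤ 1)
    (hgap : 2 < blockGap N K b f (topBlock N K b f)) : topBlock N K b f' = topBlock N K b f := by
  refine blockIndex_argMax_of_blockGap_pos ?_
  linarith [(abs_le.1 (abs_blockGap_sub_le h (N := N) (K := K) (b := b) (topBlock N K b f))).2]

/-- Candidate points: the multiples of `K` in and next to the top blocks, and a default point. -/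
noncomputable def candidate (N K : ℕ) (f : ℕ → ℝ) : Option (Bool × Fin 5) → ℕ
  | none => 0
  | some (b, s) => (4 * topBlock N K b f + s - blockOffset b) * K

/-- Score of a candidate; truncated from below at `2`, so that it stays stable when the top block
is not. -/
noncomputable def candidateScore (N K : ℕ) (g : ℝ) (f : ℕ → ℝ) : Option (Bool × Fin 5) → ℝ
  | none => g
  | some (b, s) =>
    max 2 (min (f (candidate N K f (some (b, s)))) (blockGap N K b f (topBlock N K b f)))

theorem abs_candidateScore_sub_le {N K : ℕ} {g : ℝ} {f f' : ℕ → ℝ} (h : ∀ i, |f i - f' i| ≤ 1)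
    (o : Option (Bool × Fin 5)) :
    |candidateScore N K g f o - candidateScore N K g f' o| ≤ 2 := by
  rcases o with _ | ⟨b, s⟩
  · simp [candidateScore]
  by_cases htop : topBlock N K b f' = topBlock N K b f
  · simp only [candidateScore, candidate, htop]
    refine (abs_max_sub_max_le_max _ _ _ _).trans (max_le (by simp) ?_)
    exact (abs_min_sub_min_le_max _ _ _ _).trans
      (max_le ((h _).trans one_le_two) (abs_blockGap_sub_le h _))
  · have h1 : blockGap N K b f (topBlock N K b f) ≤ 2 := by
      by_contra hcon
      exact htop (topBlock_eq_of_two_lt h (not_le.1 hcon))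
    have h2 : blockGap N K b f' (topBlock N K b f') ≤ 2 := by
      by_contra hcon
      refine htop (topBlock_eq_of_two_lt (fun i => ?_) (not_le.1 hcon)).symm
      rw [abs_sub_comm]; exact h i
    simp only [candidateScore]
    rw [max_eq_left ((min_le_right _ _).trans h1), max_eq_left ((min_le_right _ _).trans h2)]
    simp

/-- Selects a point of high score once the scale `K` at which `f` drops is known. -/
noncomputable def scaleMech (N K : ℕ) (g ε : ℝ) (f : ℕ → ℝ) : Measure ℕ :=
  expMech (fun o => ε / 4 * candidateScore N K g f o) (candidate N K f)

instance (N K : ℕ) (g ε : ℝ) (f : ℕ → ℝ) : IsProbabilityMeasure (scaleMech N K g ε f) := by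
  unfold scaleMech; infer_instance

theorem scaleMech_indist {N K : ℕ} {g ε δ : ℝ} (hε : 0 < ε) (hδ : 0 ≤ δ)
    (hg : 11 * Real.exp (ε / 4 * (2 - g)) ≤ δ) {f f' : ℕ → ℝ} (h : ∀ i, |f i - f' i| ≤ 1) :
    Indist ε δ (scaleMech N K g ε f) (scaleMech N K g ε f') := by
  have hunstable : ∀ S : Finset (Option (Bool × Fin 5)),
      (∀ o ∈ S, candidate N K f o ≠ candidate N K f' o) →
      ∑ o ∈ S, Real.exp (ε / 4 * candidateScore N K g f o) ≤
        δ * ∑ o, Real.exp (ε / 4 * candidateScore N K g f o) := by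
    intro S hS
    calc _ ≤ ∑ o ∈ S, Real.exp (ε / 4 * 2) := by
          refine Finset.sum_le_sum fun o ho => ?_
          replace ho := hS o ho
          rcases o with _ | ⟨b, s⟩
          · exact absurd rfl ho
          have hle : blockGap N K b f (topBlock N K b f) ≤ 2 := by
            by_contra hcon
            apply ho
            simp only [candidate, topBlock_eq_of_two_lt h (not_le.1 hcon)]
          simp only [candidateScore]
          rw [max_eq_left ((min_le_right _ _).trans hle)]
      _ ≤ ∑ _o : Option (Bool × Fin 5), Real.exp (ε / 4 * 2) :=
          Finset.sum_le_sum_of_subset_of_nonneg (Finset.subset_univ _)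
            fun o _ _ => (Real.exp_pos _).le
      _ = 11 * Real.exp (ε / 4 * (2 - g)) * Real.exp (ε / 4 * g) := by
          rw [mul_assoc, ← Real.exp_add]
          simp only [Finset.sum_const, Finset.card_univ, Fintype.card_option, Fintype.card_prod,
            Fintype.card_bool, Fintype.card_fin, nsmul_eq_mul]
          norm_num
          ring
      _ ≤ δ * Real.exp (ε / 4 * candidateScore N K g f none) :=
          mul_le_mul_of_nonneg_right hg (Real.exp_pos _).le
      _ ≤ _ := by
          refine mul_le_mul_of_nonneg_left ?_ hδ
          exact Finset.single_le_sum
            (f := fun o => Real.exp (ε / 4 * candidateScore N K g f o))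
            (fun o _ => (Real.exp_pos _).le) (Finset.mem_univ none)
  refine expMech_indist hδ (fun o => ?_)
    (fun o => candidate N K f o ≠ candidate N K f' o) (fun o ho => not_not.1 ho)
    (hunstable _ fun o ho => by simpa using ho)
  rw [← mul_sub, abs_mul, abs_of_pos (show 0 < ε / 4 by positivity)]
  nlinarith [abs_candidateScore_sub_le (N := N) (K := K) (g := g) h o]

theorem exists_candidate {N K : ℕ} (hK : 0 < K) {f : ℕ → ℝ} {a c r u : ℝ} {p y : ℕ}
    (hf : IsScore N f) (hp : a ≤ f p) (hq : a ≤ f (p + (K - 1)))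
    (hu : ∀ z, min (f z) (f (z + (2 * K - 1))) ≤ u) (hy : r ≤ f y) (har : a ≤ r)
    (hc : 0 < c) (hcr : c ≤ r) (hur : u + c ≤ r) :
    ∃ b s, a ≤ f (candidate N K f (some (b, s))) ∧
      c ≤ blockGap N K b f (topBlock N K b f) := by
  have htop : r ≤ f (argMax N f) := by
    rw [apply_argMax N f]; exact hy.trans (hf.apply_le_rangeMax y)
  have hmem : max u 0 < f (argMax N f) := max_lt (by linarith) (by linarith)
  set t := argMax N f / K with ht
  have ht1 : t * K ≤ argMax N f := Nat.div_mul_le_self _ _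
  have ht2 : argMax N f < (t + 1) * K := by
    rw [mul_comm]; exact Nat.lt_mul_div_succ _ hK
  obtain ⟨d, hd, hfd⟩ : ∃ d, (d = t ∨ d = t + 1) ∧ a ≤ f (d * K) := by
    rcases le_or_gt p (t * K) with h | h
    · exact ⟨t, Or.inl rfl, (le_min hp (har.trans htop)).trans (hf.quasi _ _ _ h ht1)⟩
    · refine ⟨t + 1, Or.inr rfl, (le_min (har.trans htop) hq).trans (hf.quasi _ _ _ ht2.le ?_)⟩
      rw [add_mul]; omega
  obtain ⟨b, hb⟩ : ∃ b, ∀ z, max u 0 < f z → blockIndex K b z = topBlock N K b f := by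
    classical
    have hex : ∃ z, max u 0 < f z := ⟨_, hmem⟩
    have hrange : ∀ z, max u 0 < f z →
        Nat.find hex / K ≤ z / K ∧ z / K < Nat.find hex / K + 3 := by
      intro z hz
      refine ⟨Nat.div_le_div_right (Nat.find_min' hex hz), ?_⟩
      have hlt : z < Nat.find hex + (2 * K - 1) := by
        by_contra hcon
        have h1 := hf.quasi _ _ _ (Nat.le_add_right (Nat.find hex) (2 * K - 1)) (not_lt.1 hcon)
        have h2 := lt_of_lt_of_le (lt_min (Nat.find_spec hex) hz) h1
        exact absurd (hu (Nat.find hex)) (not_le.2 (lt_of_le_of_lt (le_max_left u 0)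
          (lt_min (Nat.find_spec hex) h2)))
      rw [Nat.div_lt_iff_lt_mul hK]
      have h3 : Nat.find hex < (Nat.find hex / K + 1) * K := by
        rw [mul_comm]; exact Nat.lt_mul_div_succ _ hK
      nlinarith [Nat.sub_le (2 * K) 1]
    by_cases hmod : Nat.find hex / K % 4 < 2
    · refine ⟨false, fun z hz => ?_⟩
      have h1 := hrange z hz
      have h2 := hrange _ hmem
      simp only [topBlock, blockIndex, blockOffset]
      simp only [Bool.false_eq_true, if_false]
      omega
    · refine ⟨true, fun z hz => ?_⟩
      have h1 := hrange z hz
      have h2 := hrange _ hmem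
      simp only [topBlock, blockIndex, blockOffset]
      simp only [if_true]
      omega
  have hoff : blockOffset b ≤ 2 := by cases b <;> simp [blockOffset]
  have htb : topBlock N K b f = (t + blockOffset b) / 4 := rfl
  refine ⟨b, ⟨d + blockOffset b - 4 * topBlock N K b f, by omega⟩, ?_, ?_⟩
  · have hcand : 4 * topBlock N K b f + (d + blockOffset b - 4 * topBlock N K b f)
        - blockOffset b = d := by omega
    simpa only [candidate, hcand] using hfd
  · have hoffmax : (rangeMax N fun y => if blockIndex K b y = topBlock N K b f then 0 else f y)
        ≤ max u 0 := by
      refine rangeMax_le fun z _ => ?_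
      split_ifs with hz
      · exact le_max_right _ _
      · by_contra hcon
        exact hz (hb z (not_le.1 hcon))
    rw [blockGap, ← apply_argMax N f]
    have : max u 0 ≤ r - c := max_le (by linarith) (by linarith)
    linarith

theorem scaleMech_fail_le {N K : ℕ} (hK : 0 < K) {f : ℕ → ℝ} {g a ε β r u : ℝ} {p y : ℕ}
    (hf : IsScore N f) (hε : 0 < ε) (hg : 2 ≤ g) (ha : 0 < a)
    (hβ : 11 * Real.exp (-(ε / 4 * a)) ≤ β)
    (hp : g + a ≤ f p) (hq : g + a ≤ f (p + (K - 1)))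
    (hu : ∀ z, min (f z) (f (z + (2 * K - 1))) ≤ u) (hy : r ≤ f y) (hr : g + a ≤ r)
    (hur : u + (g + a) ≤ r) :
    scaleMech N K g ε f {i | f i < g} ≤ ENNReal.ofReal β := by
  obtain ⟨b, s, h1, h2⟩ := exists_candidate hK hf hp hq hu hy hr (by linarith) hr hur
  refine expMech_fail_le (lo := ε / 4 * g) (hi := ε / 4 * (g + a)) (some (b, s)) ?_ ?_ ?_
  · exact mul_le_mul_of_nonneg_left (le_max_of_le_right (le_min h1 h2)) (by positivity)
  · intro o ho
    refine mul_le_mul_of_nonneg_left ?_ (by positivity)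
    rcases o with _ | ⟨b, s⟩
    · exact le_rfl
    · exact max_le hg ((min_le_left _ _).trans (le_of_lt ho))
  · have : ε / 4 * g - ε / 4 * (g + a) = -(ε / 4 * a) := by ring
    rw [this]
    simpa using hβ

/-- The largest value that `f` attains at both ends of some interval of `2 ^ j` points. -/
noncomputable def intervalLevel (N : ℕ) (f : ℕ → ℝ) (j : ℕ) : ℝ :=
  rangeMax N fun x => min (f x) (f (x + (2 ^ j - 1)))

theorem IsScore.intervalLevel_anti {N : ℕ} {f : ℕ → ℝ} (hf : IsScore N f) :
    Antitone (intervalLevel N f) := by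
  intro i j hij
  refine rangeMax_le fun x hx => ?_
  refine le_trans ?_ (le_rangeMax (fun x => min (f x) (f (x + (2 ^ i - 1)))) hx)
  refine le_min (min_le_left _ _) (hf.quasi _ _ _ (Nat.le_add_right _ _) ?_)
  have := Nat.pow_le_pow_right two_pos hij
  omega

theorem IsScore.min_le_intervalLevel {N : ℕ} {f : ℕ → ℝ} (hf : IsScore N f) (j x : ℕ) :
    min (f x) (f (x + (2 ^ j - 1))) ≤ intervalLevel N f j := by
  rcases le_total x N with hx | hx
  · exact le_rangeMax (fun x => min (f x) (f (x + (2 ^ j - 1)))) hx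
  · refine le_trans ?_ (le_rangeMax (fun x => min (f x) (f (x + (2 ^ j - 1)))) (Nat.zero_le N))
    refine (min_le_left _ _).trans ?_
    rw [hf.eq_zero x hx]
    exact le_min (hf.nonneg _) (hf.nonneg _)

theorem IsScore.intervalLevel_eq_zero {N : ℕ} {f : ℕ → ℝ} (hf : IsScore N f) {j : ℕ}
    (hj : N < 2 ^ j) : intervalLevel N f j = 0 := by
  refine le_antisymm (rangeMax_le fun x _ => ?_)
    ((le_min (hf.nonneg 0) (hf.nonneg _)).trans (hf.min_le_intervalLevel j 0))
  rw [hf.eq_zero (x + (2 ^ j - 1)) (by omega)]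
  exact min_le_right _ _

theorem abs_intervalLevel_sub_le {N : ℕ} {f f' : ℕ → ℝ} (h : ∀ i, |f i - f' i| ≤ 1) (j : ℕ) :
    |intervalLevel N f j - intervalLevel N f' j| ≤ 1 :=
  abs_rangeMax_sub_le fun _ => (abs_min_sub_min_le_max _ _ _ _).trans (max_le (h _) (h _))

/-- The score of a scale `j`: high if `f` is large on an interval of `2 ^ j` points but not on
an interval of `2 ^ (j + 1)` points. -/
noncomputable def scaleScore (N : ℕ) (a r : ℝ) (f : ℕ → ℝ) (j : ℕ) : ℝ :=
  max 0 (min (intervalLevel N f j - a) (r - a - intervalLevel N f (j + 1)))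

theorem abs_scaleScore_sub_le {N : ℕ} {a r : ℝ} {f f' : ℕ → ℝ} (h : ∀ i, |f i - f' i| ≤ 1)
    (j : ℕ) : |scaleScore N a r f j - scaleScore N a r f' j| ≤ 1 := by
  refine (abs_max_sub_max_le_max _ _ _ _).trans (max_le (by simp) ?_)
  refine (abs_min_sub_min_le_max _ _ _ _).trans (max_le ?_ ?_)
  · rw [sub_sub_sub_cancel_right]; exact abs_intervalLevel_sub_le h j
  · rw [sub_sub_sub_cancel_left, abs_sub_comm]; exact abs_intervalLevel_sub_le h (j + 1)

theorem isScore_scaleScore {N N' : ℕ} {a r : ℝ} {f : ℕ → ℝ} (hf : IsScore N f) (ha : 0 ≤ a)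
    (hN : N < 2 ^ N') : IsScore N' (scaleScore N a r f) := by
  refine ⟨fun i => le_max_left _ _, fun i hi => ?_, fun i j k hij hjk => ?_⟩
  · refine max_eq_left ((min_le_left _ _).trans ?_)
    rw [hf.intervalLevel_eq_zero (hN.trans_le (Nat.pow_le_pow_right two_pos hi))]
    linarith
  · have h1 := hf.intervalLevel_anti hjk
    have h2 := hf.intervalLevel_anti (Nat.add_le_add_right hij 1)
    unfold scaleScore
    rw [← max_min_distrib_left]
    refine max_le_max le_rfl (le_min ?_ ?_)
    · exact (min_le_right _ _).trans ((min_le_left _ _).trans (by linarith))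
    · exact (min_le_left _ _).trans ((min_le_right _ _).trans (by linarith))

theorem exists_le_scaleScore {N N' : ℕ} {a r : ℝ} {f : ℕ → ℝ} (hf : IsScore N f) (hr : 0 < r)
    (hN : N < 2 ^ N') (h : ∃ i, r ≤ f i) : ∃ j, r / 2 - a ≤ scaleScore N a r f j := by
  classical
  obtain ⟨i, hi⟩ := h
  have hex : ∃ j, intervalLevel N f j < r / 2 :=
    ⟨N', by rw [hf.intervalLevel_eq_zero hN]; positivity⟩
  have h0 : Nat.find hex ≠ 0 := by
    intro h0
    have h1 := Nat.find_spec hex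
    have h2 := hf.min_le_intervalLevel 0 i
    rw [h0] at h1
    simp only [pow_zero, Nat.sub_self, add_zero, min_self] at h2
    linarith
  obtain ⟨j, hj⟩ := Nat.exists_eq_succ_of_ne_zero h0
  have h1 := Nat.find_spec hex
  have h2 := Nat.find_min hex (m := j) (by omega)
  rw [hj] at h1
  refine ⟨j, le_max_of_le_right (le_min ?_ ?_)⟩
  · linarith [not_lt.1 h2]
  · change intervalLevel N f (j + 1) < _ at h1
    linarith

theorem IsSelector.step {N N' : ℕ} {g a r ε δ β ε₀ δ₀ β₀ : ℝ} {P : (ℕ → ℝ) → Measure ℕ}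
    (hP : IsSelector N' g r ε₀ δ₀ β₀ P) (hN : N < 2 ^ N') (hε : 0 < ε) (hδ : 0 ≤ δ)
    (hδ₀ : 0 ≤ δ₀) (hβ₀ : 0 ≤ β₀)
    (hg : 2 ≤ g) (ha : 0 < a) (hgδ : 11 * Real.exp (ε / 4 * (2 - g)) ≤ δ)
    (hβ : 11 * Real.exp (-(ε / 4 * a)) ≤ β) (hgr : g ≤ r) :
    ∃ Q, IsSelector N g (2 * (r + a)) (ε₀ + ε) (δ₀ + δ) (β₀ + β) Q := by
  have hprob := hP.isProb
  have hβ' : 0 ≤ β := le_trans (by positivity) hβ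
  have hmeas : ∀ f, Measurable fun k => scaleMech N (2 ^ k) g ε f :=
    fun f => measurable_of_countable _
  have happly : ∀ f T, ((P (scaleScore N a (2 * (r + a)) f)).bind
      fun k => scaleMech N (2 ^ k) g ε f) T =
        ∫⁻ k, scaleMech N (2 ^ k) g ε f T ∂(P (scaleScore N a (2 * (r + a)) f)) :=
    fun f T => Measure.bind_apply (MeasurableSet.of_discrete) (hmeas f).aemeasurable
  refine ⟨fun f => (P (scaleScore N a (2 * (r + a)) f)).bind
    fun k => scaleMech N (2 ^ k) g ε f, fun f => ⟨?_⟩, fun f f' h T _ => ?_, fun f hf hex => ?_⟩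
  · rw [happly]
    simp
  · rw [happly, happly]
    refine (hP.indist _ _ (abs_scaleScore_sub_le h)).lintegral_comp_le hδ₀ hδ
      (measurable_of_countable _) (fun k => prob_le_one) (fun k => ?_)
    exact scaleMech_indist hε hδ hgδ h T MeasurableSet.of_discrete
  · rw [happly]
    have hgood : ∀ k, scaleMech N (2 ^ k) g ε f {i | f i < g} ≤
        Set.indicator {k | scaleScore N a (2 * (r + a)) f k < g} 1 k + ENNReal.ofReal β := by
      intro k
      by_cases hk : scaleScore N a (2 * (r + a)) f k < g
      · rw [Set.indicator_of_mem (show k ∈ {k | scaleScore N a (2 * (r + a)) f k < g} from hk)]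
        exact prob_le_one.trans le_self_add
      · refine le_trans ?_ le_add_self
        have hk1 : g ≤ min (intervalLevel N f k - a)
            (2 * (r + a) - a - intervalLevel N f (k + 1)) := by
          rcases le_max_iff.1 (not_lt.1 hk) with h | h
          · linarith
          · exact h
        obtain ⟨hk2, hk3⟩ := le_min_iff.1 hk1
        obtain ⟨p, _, hp⟩ := exists_eq_rangeMax N fun x => min (f x) (f (x + (2 ^ k - 1)))
        have hp' : g + a ≤ min (f p) (f (p + (2 ^ k - 1))) := by
          rw [hp]; change _ ≤ intervalLevel N f k; linarith
        obtain ⟨y, hy⟩ := hex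
        refine scaleMech_fail_le (u := intervalLevel N f (k + 1)) (by positivity) hf hε hg ha hβ
          (le_min_iff.1 hp').1 (le_min_iff.1 hp').2 (fun z => ?_) hy (by linarith) (by linarith)
        have := hf.min_le_intervalLevel (k + 1) z
        rwa [pow_succ, mul_comm] at this
    refine (lintegral_mono hgood).trans ?_
    rw [lintegral_add_right _ measurable_const, lintegral_indicator_one MeasurableSet.of_discrete,
      ENNReal.ofReal_add hβ₀ hβ']
    refine add_le_add (hP.fail_le _ (isScore_scaleScore hf ha.le hN) ?_) (by simp)
    obtain ⟨j, hj⟩ := exists_le_scaleScore (a := a) hf (r := 2 * (r + a)) (by linarith) hN hex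
    exact ⟨j, by linarith⟩

/-- Domain sizes handled by `h` recursion levels. -/
def towerSize : ℕ → ℕ
  | 0 => 2
  | h + 1 => 2 ^ towerSize h - 1

theorem exists_isSelector {g a ε δ β : ℝ} (hε : 0 < ε) (hδ : 0 ≤ δ)
    (hg : 2 ≤ g) (ha : 0 < a) (hgδ : 11 * Real.exp (ε / 4 * (2 - g)) ≤ δ)
    (hβ : 11 * Real.exp (-(ε / 4 * a)) ≤ β) (h : ℕ) :
    ∃ P, IsSelector (towerSize h) g (2 ^ h * (g + 3 * a) - 2 * a)
      ((h + 1) * ε) ((h + 1) * δ) ((h + 1) * β) P := by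
  have hβ' : 0 ≤ β := le_trans (by positivity) hβ
  induction h with
  | zero =>
    obtain ⟨P, hP⟩ := exists_isSelector_two (g := g) (by linarith) ha hε hδ hβ
    refine ⟨P, ?_⟩
    convert hP using 1
    · rfl
    all_goals push_cast; ring
  | succ h ih =>
    obtain ⟨P, hP⟩ := ih
    have h2 : (1 : ℝ) ≤ 2 ^ h := one_le_pow₀ one_le_two
    have h3 : g + 3 * a ≤ 2 ^ h * (g + 3 * a) := le_mul_of_one_le_left (by linarith) h2
    obtain ⟨Q, hQ⟩ := hP.step (N := towerSize (h + 1))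
      (Nat.sub_lt (by positivity) one_pos) hε hδ (by positivity) (by positivity) hg ha
      hgδ hβ (by linarith)
    refine ⟨Q, ?_⟩
    convert hQ using 1 <;> push_cast <;> ring

theorem exists_perm_of_ofFn_perm {n : ℕ} {s s' : Fin n → ℝ}
    (h : (List.ofFn s).Perm (List.ofFn s')) : ∃ σ : Equiv.Perm (Fin n), s = s' ∘ σ := by
  have h1 : (List.ofFn (s ∘ Tuple.sort s)).Perm (List.ofFn (s' ∘ Tuple.sort s')) :=
    ((Tuple.sort s).ofFn_comp_perm s).trans (h.trans ((Tuple.sort s').ofFn_comp_perm s').symm)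
  have h2 : s ∘ Tuple.sort s = s' ∘ Tuple.sort s' :=
    List.ofFn_injective (h1.eq_of_pairwise' (Tuple.monotone_sort s).sortedLE_ofFn.pairwise
      (Tuple.monotone_sort s').sortedLE_ofFn.pairwise)
  refine ⟨(Tuple.sort s).symm.trans (Tuple.sort s'), ?_⟩
  funext i
  have := congrFun h2 ((Tuple.sort s).symm i)
  simpa using this

theorem List.exists_drop_append_cons {α : Type*} (x : α) :
    ∀ (k : ℕ) (l₁ l₂ : List α), k ≤ (l₁ ++ l₂).length →
      ∃ p z q, (l₁ ++ x :: l₂).drop k = p ++ z :: q ∧ (l₁ ++ l₂).drop k = p ++ q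
  | 0, l₁, l₂, _ => ⟨l₁, x, l₂, rfl, rfl⟩
  | k + 1, [], [], h => by simp at h
  | k + 1, [], y :: l₂, h => by
    simpa using List.exists_drop_append_cons y k [] l₂ (by simpa using h)
  | k + 1, y :: l₁, l₂, h => by
    simpa using List.exists_drop_append_cons x k l₁ l₂ (by simpa using h)

theorem List.exists_take_append_cons_perm {α : Type*} (z : α) :
    ∀ (n : ℕ) (p q : List α), ∃ z', ((p ++ z :: q).take (n + 1)).Perm (z' :: (p ++ q).take n)
  | n, [], q => ⟨z, by simp⟩
  | 0, y :: p, q => ⟨y, by simp⟩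
  | n + 1, y :: p, q => by
    obtain ⟨z', h⟩ := List.exists_take_append_cons_perm z n p q
    exact ⟨z', by simpa using (h.cons y).trans (List.Perm.swap _ _ _)⟩

/-- Inserting an element into a list changes a window of it, as a multiset, by one entry. -/
theorem List.exists_window_orderedInsert_perm (x : ℝ) (c : List ℝ) {k : ℕ} (n : ℕ)
    (hk : k ≤ c.length) :
    ∃ z, (((c.orderedInsert (· ≤ ·) x).drop k).take (n + 1)).Perm (z :: (c.drop k).take n) := by
  rw [List.orderedInsert_eq_take_drop]
  have hc := List.takeWhile_append_dropWhile (p := fun b => decide ¬ x ≤ b) (l := c)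
  obtain ⟨p, z, q, h1, h2⟩ := List.exists_drop_append_cons x k
    (c.takeWhile fun b => decide ¬ x ≤ b) (c.dropWhile fun b => decide ¬ x ≤ b) (by rwa [hc])
  rw [hc] at h2
  rw [h1, h2]
  exact List.exists_take_append_cons_perm z n p q

/-- The `n` middle entries of a database, in increasing order. -/
noncomputable def middle {m n : ℕ} (hnm : n ≤ m) (D : Fin m → ℝ) (j : Fin n) : ℝ :=
  D (Tuple.sort D ⟨(m - n) / 2 + j, by omega⟩)

theorem ofFn_middle {m n : ℕ} (hnm : n ≤ m) (D : Fin m → ℝ) :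
    List.ofFn (middle hnm D) =
      (((List.ofFn D).insertionSort (· ≤ ·)).drop ((m - n) / 2)).take n := by
  have h : (List.ofFn D).insertionSort (· ≤ ·) = List.ofFn (D ∘ Tuple.sort D) :=
    ((List.perm_insertionSort _ _).trans ((Tuple.sort D).ofFn_comp_perm D).symm).eq_of_pairwise'
      (List.pairwise_insertionSort _ _) (Tuple.monotone_sort D).sortedLE_ofFn.pairwise
  rw [h]
  refine List.ext_getElem ?_ fun i h1 h2 => ?_
  · simp only [List.length_ofFn, List.length_take, List.length_drop]
    omega
  · simp [middle]

theorem ofFn_perm_cons_succAbove {m : ℕ} (D : Fin (m + 1) → ℝ) (i : Fin (m + 1)) :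
    (List.ofFn D).Perm (D i :: List.ofFn fun j => D (i.succAbove j)) := by
  rw [← Multiset.coe_eq_coe, ← Multiset.cons_coe, ← Fin.univ_val_map, ← Fin.univ_val_map,
    Fin.univ_succAbove m i]
  simp [Function.comp_def]

theorem exists_middle_eq_comp_perm {m n : ℕ} (hn : 0 < n) (hnm : n ≤ m) {D D' : Fin m → ℝ}
    {i₀ : Fin m} (h : ∀ j, j ≠ i₀ → D j = D' j) :
    ∃ (v v' : Fin n → ℝ) (j₀ : Fin n) (σ σ' : Equiv.Perm (Fin n)),
      (∀ j, j ≠ j₀ → v j = v' j) ∧ middle hnm D = v ∘ σ ∧ middle hnm D' = v' ∘ σ' := by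
  obtain ⟨n, rfl⟩ := Nat.exists_eq_succ_of_ne_zero hn.ne'
  obtain ⟨m, rfl⟩ := Nat.exists_eq_succ_of_ne_zero (hn.trans_le hnm).ne'
  set c := (List.ofFn fun j => D (i₀.succAbove j)).insertionSort (· ≤ ·) with hc
  have hlen : c.length = m := by simp [hc]
  have hk : (m + 1 - (n + 1)) / 2 + n ≤ m := by omega
  obtain ⟨w, hw⟩ : ∃ w, w = (c.drop ((m + 1 - (n + 1)) / 2)).take n := ⟨_, rfl⟩
  have hwlen : w.length = n := by
    simp only [hw, List.length_take, List.length_drop, hlen]; omega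
  have hofn : (List.ofFn fun i : Fin n => w.getD i 0) = w :=
    List.ext_getElem (by simp [hwlen]) fun i h1 h2 => by simp [h2]
  have key : ∀ E : Fin (m + 1) → ℝ, (∀ j, j ≠ i₀ → D j = E j) →
      ∃ (z : ℝ) (σ : Equiv.Perm (Fin (n + 1))),
        middle hnm E = (Fin.cons z fun i => w.getD i 0 : Fin (n + 1) → ℝ) ∘ σ := by
    intro E hE
    have h1 : (List.ofFn E).insertionSort (· ≤ ·) = c.orderedInsert (· ≤ ·) (E i₀) := by
      have h2 : (List.ofFn fun j => E (i₀.succAbove j)) = List.ofFn fun j => D (i₀.succAbove j) :=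
        congrArg List.ofFn (funext fun j => (hE _ (Fin.succAbove_ne i₀ j)).symm)
      have h3 := ofFn_perm_cons_succAbove E i₀
      rw [h2] at h3
      have h4 : ((List.ofFn E).insertionSort (· ≤ ·)).Perm (c.orderedInsert (· ≤ ·) (E i₀)) :=
        ((List.perm_insertionSort _ _).trans h3).trans
          (((List.perm_insertionSort _ _).symm.cons _).trans (List.perm_orderedInsert _ _ _).symm)
      exact h4.eq_of_pairwise' (List.pairwise_insertionSort _ _)
        ((List.pairwise_insertionSort _ _).orderedInsert _ _)
    obtain ⟨z, hz⟩ := List.exists_window_orderedInsert_perm (E i₀) c n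
      (k := (m + 1 - (n + 1)) / 2) (by omega)
    refine ⟨z, exists_perm_of_ofFn_perm ?_⟩
    rw [ofFn_middle, h1, List.ofFn_cons, hofn, hw]
    exact hz
  obtain ⟨z, σ, hz⟩ := key D fun _ _ => rfl
  obtain ⟨z', σ', hz'⟩ := key D' h
  refine ⟨_, _, 0, σ, σ', fun j hj => ?_, hz, hz'⟩
  obtain ⟨j, rfl⟩ := Fin.exists_succ_eq.2 hj
  simp

/-- The mechanism `M` run on a uniformly random reordering of its input. -/
noncomputable def symMech {Ω : Type*} [MeasurableSpace Ω] {n : ℕ}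
    (M : (Fin n → ℝ) → Measure Ω) (s : Fin n → ℝ) : Measure Ω :=
  (Fintype.card (Equiv.Perm (Fin n)) : ℝ≥0∞)⁻¹ • ∑ σ : Equiv.Perm (Fin n), M (s ∘ σ)

theorem symMech_apply {Ω : Type*} [MeasurableSpace Ω] {n : ℕ} (M : (Fin n → ℝ) → Measure Ω)
    (s : Fin n → ℝ) (T : Set Ω) : symMech M s T =
      (Fintype.card (Equiv.Perm (Fin n)) : ℝ≥0∞)⁻¹ * ∑ σ : Equiv.Perm (Fin n), M (s ∘ σ) T := by
  simp [symMech]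

theorem card_perm_inv_mul_sum_const {n : ℕ} (c : ℝ≥0∞) :
    (Fintype.card (Equiv.Perm (Fin n)) : ℝ≥0∞)⁻¹ * ∑ _σ : Equiv.Perm (Fin n), c = c := by
  rw [Finset.sum_const, Finset.card_univ, nsmul_eq_mul, ← mul_assoc, ENNReal.inv_mul_cancel
    (Nat.cast_ne_zero.2 Fintype.card_ne_zero) (ENNReal.natCast_ne_top _), one_mul]

theorem isProbabilityMeasure_symMech {Ω : Type*} [MeasurableSpace Ω] {n : ℕ}
    {M : (Fin n → ℝ) → Measure Ω} (hM : ∀ s, IsProbabilityMeasure (M s)) (s : Fin n → ℝ) :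
    IsProbabilityMeasure (symMech M s) := by
  refine ⟨?_⟩
  rw [symMech_apply]
  simp only [measure_univ]
  exact card_perm_inv_mul_sum_const 1

theorem symMech_comp_perm {Ω : Type*} [MeasurableSpace Ω] {n : ℕ}
    (M : (Fin n → ℝ) → Measure Ω) (s : Fin n → ℝ) (τ : Equiv.Perm (Fin n)) :
    symMech M (s ∘ τ) = symMech M s := by
  unfold symMech
  congr 1
  exact Equiv.sum_comp (Equiv.mulLeft τ) fun σ => M (s ∘ σ)

theorem symMech_indist {Ω : Type*} [MeasurableSpace Ω] {n : ℕ} {X : Set ℝ}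
    {M : (Fin n → ℝ) → Measure Ω} {ε δ : ℝ} (hε : 0 ≤ ε) (hM : IsDPOn X M ε δ)
    {s s' : Fin n → ℝ} (hs : ∀ i, s i ∈ X) (hs' : ∀ i, s' i ∈ X) {i₀ : Fin n}
    (h : ∀ j, j ≠ i₀ → s j = s' j) : Indist ε δ (symMech M s) (symMech M s') := by
  intro T hT
  have key : ∀ σ : Equiv.Perm (Fin n),
      M (s ∘ σ) T ≤ ENNReal.ofReal (Real.exp ε) * M (s' ∘ σ) T + ENNReal.ofReal δ := by
    intro σ
    by_cases h0 : s i₀ = s' i₀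
    · have hss : s = s' := funext fun j => by
        by_cases hj : j = i₀
        · rw [hj, h0]
        · exact h j hj
      rw [hss]
      exact Indist.refl hε _ T hT
    · refine hM _ _ (fun i => hs _) (fun i => hs' _) ⟨σ.symm i₀, by simpa using h0, ?_⟩ T hT
      intro j hj
      exact h _ fun hcon => hj (by simp [← hcon])
  rw [symMech_apply, symMech_apply]
  calc _ ≤ (Fintype.card (Equiv.Perm (Fin n)) : ℝ≥0∞)⁻¹ * ∑ σ : Equiv.Perm (Fin n),
        (ENNReal.ofReal (Real.exp ε) * M (s' ∘ σ) T + ENNReal.ofReal δ) := by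
        gcongr with σ
        exact key σ
    _ = _ := by
        rw [Finset.sum_add_distrib, mul_add, card_perm_inv_mul_sum_const, ← Finset.mul_sum,
          mul_left_comm]

theorem intervalCount_comp_perm {n : ℕ} (s : Fin n → ℝ) (σ : Equiv.Perm (Fin n)) (a b : ℝ) :
    intervalCount (s ∘ σ) a b = intervalCount s a b :=
  Nat.card_congr (σ.subtypeEquiv fun _ => Iff.rfl)

theorem rOpt1_comp_perm {n : ℕ} (X : Set ℝ) (s : Fin n → ℝ) (σ : Equiv.Perm (Fin n)) (t : ℕ) :
    rOpt1 X (s ∘ σ) t = rOpt1 X s t := by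
  simp only [rOpt1, intervalCount_comp_perm]

theorem Solves1Cluster.symMech {n : ℕ} {X : Set ℝ} {M : (Fin n → ℝ) → Measure (ℝ × ℝ≥0)}
    {t : ℕ} {Δ : ℤ} {w β : ℝ} (h : Solves1Cluster X M t Δ w β) :
    Solves1Cluster X (symMech M) t Δ w β := by
  intro s hs
  rw [symMech_apply, ← card_perm_inv_mul_sum_const (n := n) (ENNReal.ofReal (1 - β))]
  gcongr with σ
  have := h (s ∘ σ) fun i => hs _
  simpa only [intervalCount_comp_perm, rOpt1_comp_perm] using this

/-- How deep `y` lies inside the database `D`. -/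
noncomputable def rankScore {m : ℕ} (D : Fin m → ℝ) (y : ℝ) : ℕ :=
  min (Finset.univ.filter fun i => D i ≤ y).card (Finset.univ.filter fun i => y ≤ D i).card

theorem measurable_rankScore {m : ℕ} (D : Fin m → ℝ) : Measurable (rankScore D) := by
  unfold rankScore
  simp only [Finset.card_filter]
  refine Measurable.min ?_ ?_ <;>
    refine Finset.measurable_sum _ fun i _ => Measurable.ite ?_ measurable_const measurable_const
  · exact measurableSet_Ici
  · exact measurableSet_Iic

theorem rankScore_quasi {m : ℕ} (D : Fin m → ℝ) {x y z : ℝ} (hxy : x ≤ y) (hyz : y ≤ z) :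
    min (rankScore D x) (rankScore D z) ≤ rankScore D y := by
  unfold rankScore
  refine le_min ?_ ?_
  · refine (min_le_left _ _).trans ((min_le_left _ _).trans (Finset.card_le_card ?_))
    exact Finset.monotone_filter_right _ fun i _ hi => le_trans hi hxy
  · refine (min_le_right _ _).trans ((min_le_right _ _).trans (Finset.card_le_card ?_))
    exact Finset.monotone_filter_right _ fun i _ hi => le_trans hyz hi

theorem rankScore_le_add_one {m : ℕ} {D D' : Fin m → ℝ} {i₀ : Fin m}
    (h : ∀ j, j ≠ i₀ → D j = D' j) (y : ℝ) : rankScore D y ≤ rankScore D' y + 1 := by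
  have key : ∀ p : ℝ → Prop, ∀ [DecidablePred p],
      (Finset.univ.filter fun i => p (D i)).card ≤
        (Finset.univ.filter fun i => p (D' i)).card + 1 := by
    intro p _
    refine le_trans (Finset.card_le_card ?_) (Finset.card_insert_le i₀ _)
    intro i hi
    by_cases hii : i = i₀
    · simp [hii]
    · simpa [hii, ← h i hii] using hi
  unfold rankScore
  have h1 := key fun x => x ≤ y
  have h2 := key fun x => y ≤ x
  omega

theorem lt_rankScore_of_middle {m n : ℕ} (hnm : n ≤ m) (D : Fin m → ℝ) {y : ℝ} {j₁ j₂ : Fin n}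
    (h₁ : middle hnm D j₁ ≤ y) (h₂ : y ≤ middle hnm D j₂) : (m - n) / 2 < rankScore D y := by
  have hmono := Tuple.monotone_sort D
  refine lt_min ?_ ?_
  · calc (m - n) / 2 < (Finset.Iic (⟨(m - n) / 2 + j₁, by omega⟩ : Fin m)).card := by
          rw [Fin.card_Iic]; simp only; omega
      _ = ((Finset.Iic (⟨(m - n) / 2 + j₁, by omega⟩ : Fin m)).map
            (Tuple.sort D).toEmbedding).card := (Finset.card_map _).symm
      _ ≤ _ := by
          refine Finset.card_le_card fun i hi => ?_
          obtain ⟨a, ha, rfl⟩ := Finset.mem_map.1 hi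
          simpa using (hmono (Finset.mem_Iic.1 ha)).trans h₁
  · calc (m - n) / 2 < (Finset.Ici (⟨(m - n) / 2 + j₂, by omega⟩ : Fin m)).card := by
          rw [Fin.card_Ici]; simp only; omega
      _ = ((Finset.Ici (⟨(m - n) / 2 + j₂, by omega⟩ : Fin m)).map
            (Tuple.sort D).toEmbedding).card := (Finset.card_map _).symm
      _ ≤ _ := by
          refine Finset.card_le_card fun i hi => ?_
          obtain ⟨a, ha, rfl⟩ := Finset.mem_map.1 hi
          simpa using h₂.trans (hmono (Finset.mem_Ici.1 ha))

theorem interior_of_rankScore_pos {m : ℕ} {D : Fin m → ℝ} {y : ℝ} (h : 0 < rankScore D y) :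
    sInf (Set.range D) ≤ y ∧ y ≤ sSup (Set.range D) := by
  obtain ⟨h1, h2⟩ := lt_min_iff.1 h
  obtain ⟨i, hi⟩ := Finset.card_pos.1 h1
  obtain ⟨j, hj⟩ := Finset.card_pos.1 h2
  exact ⟨(csInf_le (Set.finite_range D).bddBelow ⟨i, rfl⟩).trans (Finset.mem_filter.1 hi).2,
    (Finset.mem_filter.1 hj).2.trans (le_csSup (Set.finite_range D).bddAbove ⟨j, rfl⟩)⟩

theorem exists_iterate_logb_le_one :
    ∀ (n : ℕ) (x : ℝ), x ≤ n + 1 → ∃ k, (Real.logb 2)^[k] x ≤ 1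
  | 0, x, h => ⟨0, by simpa using h⟩
  | n + 1, x, h => by
    by_cases hx : x ≤ 1
    · exact ⟨0, hx⟩
    obtain ⟨k, hk⟩ := exists_iterate_logb_le_one n (Real.logb 2 x) (by
      rw [Real.logb_le_iff_le_rpow one_lt_two (by linarith)]
      have h1 : n + 1 < 2 ^ (n + 1) := Nat.lt_two_pow_self
      have h2 : ((n + 1 + 1 : ℕ) : ℝ) ≤ ((2 ^ (n + 1) : ℕ) : ℝ) := Nat.cast_le.2 h1
      push_cast at h h2
      rw [← Nat.cast_add_one, Real.rpow_natCast]
      exact h.trans h2)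
    exact ⟨k + 1, hk⟩

theorem iterate_logb_logStar_le_one (x : ℝ) : (Real.logb 2)^[logStar x] x ≤ 1 := by
  obtain ⟨n, hn⟩ := exists_nat_ge x
  exact Nat.sInf_mem (s := {k : ℕ | (Real.logb 2)^[k] x ≤ 1})
    (exists_iterate_logb_le_one n x (by linarith))

theorem logStar_pos {x : ℝ} (hx : 1 < x) : 0 < logStar x := by
  by_contra h
  have := iterate_logb_logStar_le_one x
  rw [Nat.eq_zero_of_not_pos h] at this
  exact absurd this (not_le.2 hx)

theorem two_le_towerSize : ∀ h, 2 ≤ towerSize h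
  | 0 => le_rfl
  | h + 1 => by
    have := Nat.pow_le_pow_right (n := 2) two_pos (two_le_towerSize h)
    simp only [towerSize]
    omega

theorem add_one_le_towerSize :
    ∀ (h : ℕ) (x : ℝ), (Real.logb 2)^[h] x ≤ 1 → x + 1 ≤ towerSize h
  | 0, x, hx => by
    simp only [Function.iterate_zero, id] at hx
    simp only [towerSize, Nat.cast_ofNat]
    linarith
  | h + 1, x, hx => by
    rcases le_or_gt x 0 with h0 | h0
    · have : ((2 : ℕ) : ℝ) ≤ towerSize (h + 1) := Nat.cast_le.2 (two_le_towerSize _)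
      push_cast at this
      linarith
    have h1 := add_one_le_towerSize h (Real.logb 2 x) hx
    obtain ⟨b, hb⟩ := Nat.exists_eq_add_of_le (two_le_towerSize h)
    have h2 : x ≤ 2 ^ (1 + b) := by
      rw [← Real.rpow_natCast, ← Real.logb_le_iff_le_rpow one_lt_two h0]
      rw [hb] at h1
      push_cast at h1 ⊢
      linarith
    have h3 : ((towerSize (h + 1) : ℕ) : ℝ) = 2 ^ (2 + b) - 1 := by
      simp only [towerSize, hb]
      rw [Nat.cast_sub Nat.one_le_two_pow]
      push_cast
      ring
    have h4 : (1 : ℝ) ≤ 2 ^ b := one_le_pow₀ one_le_two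
    rw [h3]
    ring_nf at h2 ⊢
    linarith

/-- The `i`-th of `K + 1` equally spaced points of the interval with center `cr.1` and radius
`cr.2`. -/
noncomputable def grid (K : ℕ) (cr : ℝ × ℝ≥0) (i : ℕ) : ℝ :=
  cr.1 - cr.2 + i * (2 * cr.2 / K)

/-- The depths of the points of the grid in the database `D`, extended by `0`. -/
noncomputable def gridScore {m : ℕ} (D : Fin m → ℝ) (K : ℕ) (cr : ℝ × ℝ≥0) (i : ℕ) : ℝ :=
  if i ≤ K then rankScore D (grid K cr i) else 0

theorem measurable_grid (K i : ℕ) : Measurable fun cr => grid K cr i := by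
  unfold grid
  fun_prop

theorem grid_mono (K : ℕ) (cr : ℝ × ℝ≥0) : Monotone (grid K cr) := fun i j hij => by
  unfold grid
  gcongr

theorem measurable_comp_gridScore {m : ℕ} (D : Fin m → ℝ) (K : ℕ) {α : Type*} [MeasurableSpace α]
    (F : (ℕ → ℝ) → α) : Measurable fun cr => F (gridScore D K cr) := by
  have h1 : Measurable fun cr => fun i : Fin (K + 1) => rankScore D (grid K cr i) :=
    measurable_pi_lambda _ fun i => (measurable_rankScore D).comp (measurable_grid K i)
  have h2 : Measurable fun v : Fin (K + 1) → ℕ =>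
      F fun i => if h : i ≤ K then (v ⟨i, Nat.lt_succ_of_le h⟩ : ℝ) else 0 :=
    measurable_of_countable _
  exact h2.comp h1

theorem isScore_gridScore {m : ℕ} (D : Fin m → ℝ) (K : ℕ) (cr : ℝ × ℝ≥0) :
    IsScore (K + 1) (gridScore D K cr) := by
  have h0 : ∀ i, 0 ≤ gridScore D K cr i := fun i => by
    unfold gridScore
    split_ifs <;> positivity
  refine ⟨h0, fun i hi => if_neg (by omega), fun i j k hij hjk => ?_⟩
  by_cases hk : k ≤ K
  · simp only [gridScore, hk, hjk.trans hk, hij.trans (hjk.trans hk), if_true]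
    exact_mod_cast rankScore_quasi D (grid_mono K cr hij) (grid_mono K cr hjk)
  · exact (min_le_right _ _).trans ((if_neg hk).trans_le (h0 j))

theorem abs_gridScore_sub_le {m : ℕ} {D D' : Fin m → ℝ} {i₀ : Fin m}
    (h : ∀ j, j ≠ i₀ → D j = D' j) (K : ℕ) (cr : ℝ × ℝ≥0) (i : ℕ) :
    |gridScore D K cr i - gridScore D' K cr i| ≤ 1 := by
  unfold gridScore
  split_ifs
  · have h1 := rankScore_le_add_one h (grid K cr i)
    have h2 := rankScore_le_add_one (fun j hj => (h j hj).symm) (grid K cr i)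
    rify at h1 h2
    exact abs_le.2 ⟨by linarith, by linarith⟩
  · simp

theorem intervalCount_eq {n : ℕ} {s : Fin n → ℝ} {a b : ℝ} (h : ∀ j, a ≤ s j ∧ s j ≤ b) :
    intervalCount s a b = n := by
  rw [intervalCount, Nat.card_congr (Equiv.subtypeUnivEquiv h), Nat.card_fin]

theorem exists_mem_of_intervalCount_pos {n : ℕ} {s : Fin n → ℝ} {a b : ℝ}
    (h : 0 < intervalCount s a b) : ∃ j, a ≤ s j ∧ s j ≤ b := by
  obtain ⟨⟨j, hj⟩⟩ := (Nat.card_pos_iff.1 h).1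
  exact ⟨j, hj⟩

/-- A fine enough grid on a good cluster has a point between two entries of the database. -/
theorem exists_grid_between {n t : ℕ} {X : Set ℝ} {s : Fin n → ℝ} (hs : ∀ i, s i ∈ X)
    (htn : t ≤ n) {w : ℝ} {K : ℕ} (hK : 2 * w < K) (hw : 0 < w) {cr : ℝ × ℝ≥0}
    {j : Fin n} (hj₁ : cr.1 - cr.2 ≤ s j) (hj₂ : s j ≤ cr.1 + cr.2)
    (hr : (cr.2 : ℝ) ≤ w * rOpt1 X s t) :
    ∃ i ≤ K, ∃ j₁ j₂, s j₁ ≤ grid K cr i ∧ grid K cr i ≤ s j₂ := by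
  classical
  have hK0 : (0 : ℝ) < K := by linarith
  have hlast : grid K cr K = cr.1 + cr.2 := by
    unfold grid
    field_simp
    ring
  by_contra! hcon
  have hside : ∀ i ≤ K, (∀ j', s j' < grid K cr i) ∨ ∀ j', grid K cr i < s j' := by
    intro i hi
    rcases lt_or_ge (grid K cr i) (s j) with h | h
    · refine Or.inr fun j' => ?_
      by_contra! h'
      exact absurd (hcon i hi j' j h') (not_lt.2 h.le)
    · exact Or.inl fun j' => hcon i hi j j' h
  have hKp : ∀ j', s j' < grid K cr K := (hside K le_rfl).resolve_right fun h => by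
    have := h j
    linarith
  have hex : ∃ i, ∀ j', s j' < grid K cr i := ⟨K, hKp⟩
  have hle : Nat.find hex ≤ K := Nat.find_min' hex hKp
  obtain ⟨i, hi⟩ : ∃ i, Nat.find hex = i + 1 := by
    refine Nat.exists_eq_succ_of_ne_zero fun h0 => ?_
    have := Nat.find_spec hex j
    rw [h0] at this
    simp only [grid, Nat.cast_zero, zero_mul, add_zero] at this
    linarith
  have hup : ∀ j', s j' < grid K cr (i + 1) := hi ▸ Nat.find_spec hex
  have hlo : ∀ j', grid K cr i < s j' :=
    (hside i (by omega)).resolve_left (Nat.find_min hex (by omega))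
  have hstep : grid K cr (i + 1) = grid K cr i + 2 * cr.2 / K := by
    unfold grid
    push_cast
    ring
  have hopt : rOpt1 X s t ≤ 2 * cr.2 / K := by
    refine csInf_le ⟨0, fun r hr => hr.1⟩ ⟨by positivity, s j, hs j, htn.trans_eq ?_⟩
    refine (intervalCount_eq fun j' => ⟨?_, ?_⟩).symm <;>
      linarith [hup j', hlo j', hup j, hlo j]
  have hpos : (0 : ℝ) < 2 * cr.2 / K := by linarith [hup j, hlo j]
  have hrpos : (0 : ℝ) < cr.2 := by
    have := (div_pos_iff_of_pos_right hK0).1 hpos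
    linarith
  have h1 : (cr.2 : ℝ) ≤ w * (2 * cr.2 / K) := hr.trans (by gcongr)
  have h2 : w * (2 * cr.2 / K) = cr.2 * (2 * w / K) := by ring
  have h3 : 2 * w / K < 1 := (div_lt_one hK0).2 hK
  nlinarith

/-- Sample a cluster from `μ`, then select a point of the grid on it with `P`. -/
noncomputable def gridMech {m : ℕ} (μ : Measure (ℝ × ℝ≥0)) (P : (ℕ → ℝ) → Measure ℕ)
    (D : Fin m → ℝ) (K : ℕ) : Measure ℝ :=
  μ.bind fun cr => (P (gridScore D K cr)).map (grid K cr)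

theorem measurable_gridMech_kernel {m : ℕ} (P : (ℕ → ℝ) → Measure ℕ) (D : Fin m → ℝ) (K : ℕ) :
    Measurable fun cr => (P (gridScore D K cr)).map (grid K cr) := by
  refine Measure.measurable_of_measurable_coe _ fun T hT => ?_
  have h : ∀ cr, (P (gridScore D K cr)).map (grid K cr) T =
      ∑' i, {cr | grid K cr i ∈ T}.indicator (fun cr => P (gridScore D K cr) {i}) cr := by
    intro cr
    rw [Measure.map_apply measurable_from_nat hT,
      ← Measure.tsum_indicator_apply_singleton _ _ (measurable_from_nat hT)]
    rfl
  simp only [h]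
  exact Measurable.tsum fun i =>
    (measurable_comp_gridScore D K fun f => P f {i}).indicator (measurable_grid K i hT)

theorem gridMech_apply {m : ℕ} (μ : Measure (ℝ × ℝ≥0)) (P : (ℕ → ℝ) → Measure ℕ)
    (D : Fin m → ℝ) (K : ℕ) {T : Set ℝ} (hT : MeasurableSet T) :
    gridMech μ P D K T = ∫⁻ cr, P (gridScore D K cr) (grid K cr ⁻¹' T) ∂μ := by
  rw [gridMech, Measure.bind_apply hT (measurable_gridMech_kernel P D K).aemeasurable]
  exact lintegral_congr fun cr => Measure.map_apply measurable_from_nat hT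

theorem isProbabilityMeasure_gridMech {m : ℕ} (μ : Measure (ℝ × ℝ≥0)) [IsProbabilityMeasure μ]
    {P : (ℕ → ℝ) → Measure ℕ} (hP : ∀ f, IsProbabilityMeasure (P f)) (D : Fin m → ℝ) (K : ℕ) :
    IsProbabilityMeasure (gridMech μ P D K) := by
  refine ⟨?_⟩
  rw [gridMech_apply _ _ _ _ MeasurableSet.univ]
  simp

theorem gridMech_indist {m N : ℕ} {g r ε₁ δ₁ ε₂ δ₂ β : ℝ} (hδ₁ : 0 ≤ δ₁) (hδ₂ : 0 ≤ δ₂)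
    {μ μ' : Measure (ℝ × ℝ≥0)} [IsProbabilityMeasure μ] (hμ : Indist ε₁ δ₁ μ μ')
    {P : (ℕ → ℝ) → Measure ℕ} (hP : IsSelector N g r ε₂ δ₂ β P) {D D' : Fin m → ℝ} {i₀ : Fin m}
    (h : ∀ j, j ≠ i₀ → D j = D' j) (K : ℕ) :
    Indist (ε₁ + ε₂) (δ₁ + δ₂) (gridMech μ P D K) (gridMech μ' P D' K) := by
  intro T hT
  rw [gridMech_apply _ _ _ _ hT, gridMech_apply _ _ _ _ hT]
  have := hP.isProb
  refine hμ.lintegral_comp_le hδ₁ hδ₂ ?_ (fun _ => prob_le_one) fun cr =>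
    hP.indist _ _ (abs_gridScore_sub_le h K cr) _ (measurable_from_nat hT)
  have h1 := (Measure.measurable_coe hT).comp (measurable_gridMech_kernel P D' K)
  have h2 : (fun cr => P (gridScore D' K cr) (grid K cr ⁻¹' T)) =
      fun cr => (P (gridScore D' K cr)).map (grid K cr) T :=
    funext fun cr => (Measure.map_apply measurable_from_nat hT).symm
  rw [h2]
  exact h1

theorem gridMech_le {m N K : ℕ} {g r ε δ β β' : ℝ} (hβ : 0 ≤ β) (hβ' : 0 ≤ β') (hg : 0 < g)
    (hK : K + 1 ≤ N) {μ : Measure (ℝ × ℝ≥0)} [IsProbabilityMeasure μ]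
    {P : (ℕ → ℝ) → Measure ℕ} (hP : IsSelector N g r ε δ β' P) {D : Fin m → ℝ}
    (hμ : ENNReal.ofReal (1 - β) ≤ μ {cr | ∃ i, r ≤ gridScore D K cr i}) :
    ENNReal.ofReal (1 - (β + β')) ≤
      gridMech μ P D K {y | sInf (Set.range D) ≤ y ∧ y ≤ sSup (Set.range D)} := by
  have hI : MeasurableSet {y | sInf (Set.range D) ≤ y ∧ y ≤ sSup (Set.range D)} := measurableSet_Icc
  have hG : MeasurableSet {cr | ∃ i, r ≤ gridScore D K cr i} :=
    measurableSet_setOfPred.2 (measurable_comp_gridScore D K fun f => ∃ i, r ≤ f i)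
  have := hP.isProb
  have := isProbabilityMeasure_gridMech μ hP.isProb D K
  set I := {y | sInf (Set.range D) ≤ y ∧ y ≤ sSup (Set.range D)} with hIdef
  set G := {cr | ∃ i, r ≤ gridScore D K cr i} with hGdef
  have hfail : gridMech μ P D K Iᶜ ≤ μ Gᶜ + ENNReal.ofReal β' := by
    rw [gridMech_apply _ _ _ _ hI.compl]
    calc _ ≤ ∫⁻ cr, (Gᶜ.indicator 1 cr + ENNReal.ofReal β') ∂μ := lintegral_mono fun cr => ?_
      _ = _ := by
        rw [lintegral_add_right _ measurable_const, lintegral_indicator_one hG.compl]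
        simp
    by_cases hcr : cr ∈ G
    · refine le_trans (le_trans (measure_mono ?_)
        (hP.fail_le _ ((isScore_gridScore D K cr).mono hK) hcr)) le_add_self
      intro i hi
      by_contra hlt
      have hi1 : 0 < gridScore D K cr i := hg.trans_le (not_lt.1 hlt)
      have hi2 := (isScore_gridScore D K cr).lt_of_pos hi1
      rw [gridScore, if_pos (by omega)] at hi1
      exact hi (interior_of_rankScore_pos (Nat.cast_pos.1 hi1))
    · refine prob_le_one.trans (le_trans ?_ le_self_add)
      rw [Set.indicator_of_mem (by exact hcr)]
      simp
  have hGc : μ Gᶜ ≤ ENNReal.ofReal β := by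
    rw [prob_compl_eq_one_sub hG, tsub_le_iff_right]
    calc (1 : ℝ≥0∞) = ENNReal.ofReal (β + (1 - β)) := by simp
      _ ≤ ENNReal.ofReal β + ENNReal.ofReal (1 - β) := ENNReal.ofReal_add_le
      _ ≤ _ := by gcongr
  rw [ENNReal.ofReal_sub _ (add_nonneg hβ hβ'), ENNReal.ofReal_one, tsub_le_iff_right,
    ENNReal.ofReal_add hβ hβ', ← prob_add_prob_compl (μ := gridMech μ P D K) hI]
  gcongr
  exact hfail.trans (by gcongr)

theorem log_eleven_div_pos {x : ℝ} (hx : 0 < x) (hx1 : x < 1) (h : ℕ) :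
    0 < Real.log (11 / (x / (h + 1))) := by
  refine Real.log_pos ((one_lt_div (by positivity)).2 ?_)
  rw [div_lt_iff₀ (by positivity)]
  have : (0 : ℝ) ≤ h := h.cast_nonneg
  linarith

theorem eleven_mul_exp_neg_log {x : ℝ} (hx : 0 < x) :
    11 * Real.exp (-Real.log (11 / x)) = x := by
  rw [← Real.log_inv, Real.exp_log (by positivity), inv_div]
  field_simp

theorem selector_threshold_le {β ε δ : ℝ} (hβ : 0 < β) (hβ1 : β < 1) (hε : 0 < ε) (hε1 : ε < 1)
    (hδ : 0 < δ) (hδ1 : δ < 1) {h : ℕ} (hh : 0 < h) :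
    2 ^ h * (2 + 4 / (ε / (h + 1)) * Real.log (11 / (δ / (h + 1))) +
        3 * (4 / (ε / (h + 1)) * Real.log (11 / (β / (h + 1))))) ≤
      8 ^ h * (144 * h / ε) * Real.logb 2 (12 * h / (β * δ)) / 2 := by
  have hh1 : (1 : ℝ) ≤ h := by exact_mod_cast hh
  set Λ := Real.log (12 * h / (β * δ)) with hΛ
  have hbd : β * δ ≤ 1 := by nlinarith
  have hbd0 : 0 < β * δ := by positivity
  have hmain : ∀ x : ℝ, 0 < x → β * δ ≤ x → Real.log (11 / (x / (h + 1))) ≤ 2 * Λ := by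
    intro x hx hbx
    have h2 : 2 * Λ = Real.log ((12 * h / (β * δ)) ^ 2) := by
      rw [Real.log_pow, Nat.cast_ofNat]
    rw [h2]
    refine Real.log_le_log (by positivity) ?_
    have h3 : 11 / (x / (h + 1)) ≤ 22 * h / (β * δ) := by
      rw [div_div_eq_mul_div]
      exact div_le_div₀ (by positivity) (by linarith) hbd0 hbx
    have h4 : 1 ≤ h / (β * δ) := by rw [le_div_iff₀ hbd0]; linarith
    have h5 : 22 * h / (β * δ) = 22 * (h / (β * δ)) := by ring
    have h6 : (12 * h / (β * δ)) ^ 2 = 144 * (h / (β * δ)) * (h / (β * δ)) := by ring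
    rw [h6]
    nlinarith
  have hΛ1 : 1 ≤ Λ := by
    rw [hΛ, Real.le_log_iff_exp_le (by positivity), le_div_iff₀ hbd0]
    nlinarith [Real.exp_one_lt_three, Real.exp_pos 1]
  have hΛ2 : Λ ≤ Real.logb 2 (12 * h / (β * δ)) := by
    rw [Real.logb, le_div_iff₀ (Real.log_pos one_lt_two)]
    nlinarith [Real.log_two_lt_d9]
  have hd := hmain δ hδ (by nlinarith)
  have hb := hmain β hβ (by nlinarith)
  have hcoef : 4 / (ε / (h + 1)) ≤ 8 * (h / ε) := by
    rw [div_div_eq_mul_div, ← mul_div_assoc]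
    exact div_le_div_of_nonneg_right (by linarith) hε.le
  have hhe : 1 ≤ h / ε := by rw [le_div_iff₀ hε]; linarith
  have hd0 := (log_eleven_div_pos hδ hδ1 h).le
  have hb0 := (log_eleven_div_pos hβ hβ1 h).le
  have hc0 : 0 ≤ 4 / (ε / (h + 1)) := by positivity
  have hpow : (2 : ℝ) ^ h ≤ 8 ^ h := by gcongr; norm_num
  calc _ ≤ (2 : ℝ) ^ h * (2 + 8 * (h / ε) * (2 * Λ) + 3 * (8 * (h / ε) * (2 * Λ))) := by
        gcongr
    _ ≤ 8 ^ h * (72 * (h / ε) * Real.logb 2 (12 * h / (β * δ))) := by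
        gcongr
        nlinarith
    _ = _ := by ring

theorem one_cluster_to_interior_point
    (β ε δ : ℝ) (hβ : 0 < β) (hβ1 : β < 1) (hε : 0 < ε) (hε1 : ε < 1)
    (hδ : 0 < δ) (hδ1 : δ < 1)
    (n t : ℕ) (Δ : ℤ) (w : ℝ) (hw : 1 ≤ w) (hΔt : Δ < (t : ℤ)) (htn : t ≤ n)
    (X : Set ℝ) (hX : X.Finite)
    (h : ∃ M : (Fin n → ℝ) → Measure (ℝ × ℝ≥0),
      (∀ S, IsProbabilityMeasure (M S)) ∧ IsDPOn X M ε δ ∧ Solves1Cluster X M t Δ w β) :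
    ∀ m : ℕ,
      (n : ℝ) + (8 : ℝ) ^ (logStar (4 * w)) * (144 * (logStar (4 * w) : ℝ) / ε) *
          Real.logb 2 (12 * (logStar (4 * w) : ℝ) / (β * δ)) ≤ (m : ℝ) →
      ∃ A : (Fin m → ℝ) → Measure ℝ,
        (∀ D, IsProbabilityMeasure (A D)) ∧ IsDPOn X A (2 * ε) (2 * δ) ∧
          SolvesIntPoint X A (2 * β) := by

  obtain ⟨M, hMp, hMdp, hMs⟩ := h
  intro m hm
  set k := logStar (4 * w) with hk
  have hk0 : 0 < k := logStar_pos (by linarith)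
  have hk1 : ((k : ℕ) : ℝ) + 1 ≠ 0 := by positivity
  set ε₀ := ε / (k + 1) with hε₀
  have hε₀0 : 0 < ε₀ := by positivity
  set a := 4 / ε₀ * Real.log (11 / (β / (k + 1))) with ha
  set g := 2 + 4 / ε₀ * Real.log (11 / (δ / (k + 1))) with hg
  have ha0 : 0 < a := mul_pos (by positivity) (log_eleven_div_pos hβ hβ1 k)
  have hg2 : 2 ≤ g := by
    have := mul_pos (a := 4 / ε₀) (by positivity) (log_eleven_div_pos hδ hδ1 k)
    linarith
  have hga : 2 ^ k * (g + 3 * a) ≤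
      8 ^ k * (144 * k / ε) * Real.logb 2 (12 * k / (β * δ)) / 2 :=
    selector_threshold_le hβ hβ1 hε hε1 hδ hδ1 hk0
  obtain ⟨P, hP⟩ := exists_isSelector (δ := δ / (k + 1)) (β := β / (k + 1)) hε₀0 (by positivity)
    hg2 ha0
    (by
      have : ε₀ / 4 * (2 - g) = -Real.log (11 / (δ / (k + 1))) := by
        rw [hg]; field_simp; ring
      rw [this, eleven_mul_exp_neg_log (by positivity)])
    (by
      have : ε₀ / 4 * a = Real.log (11 / (β / (k + 1))) := by
        rw [ha]; field_simp
      rw [this, eleven_mul_exp_neg_log (by positivity)]) k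
  rw [hε₀, mul_div_cancel₀ _ hk1, mul_div_cancel₀ _ hk1, mul_div_cancel₀ _ hk1] at hP
  have hpow : 0 < (2 : ℝ) ^ k * (g + 3 * a) := by positivity
  have hnm : n ≤ m := by
    rw [← Nat.cast_le (α := ℝ)]
    linarith
  have hΔt' : (0 : ℝ) < t - Δ := by
    rw [sub_pos]
    exact_mod_cast hΔt
  set K := ⌊2 * w⌋₊ + 1 with hK
  have hKw : 2 * w < K := by
    rw [hK]
    push_cast
    exact Nat.lt_floor_add_one _
  have hKN : K + 1 ≤ towerSize k := by
    have h1 := add_one_le_towerSize k _ (iterate_logb_logStar_le_one (4 * w))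
    have h2 : ((K : ℕ) : ℝ) ≤ 2 * w + 1 := by
      rw [hK]
      push_cast
      linarith [Nat.floor_le (show 0 ≤ 2 * w by linarith)]
    rw [← Nat.cast_le (α := ℝ)]
    push_cast
    linarith
  have hmid : ∀ {D : Fin m → ℝ}, (∀ i, D i ∈ X) → ∀ j, middle hnm D j ∈ X := fun hD j => hD _
  have := fun s => isProbabilityMeasure_symMech hMp s
  refine ⟨fun D => gridMech (symMech M (middle hnm D)) P D K,
    fun D => isProbabilityMeasure_gridMech _ hP.isProb D K, ?_, ?_⟩
  · rintro D D' hD hD' ⟨i₀, -, hi₀⟩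
    have hμ : Indist ε δ (symMech M (middle hnm D)) (symMech M (middle hnm D')) := by
      rcases Nat.eq_zero_or_pos n with rfl | hn
      · rw [Subsingleton.elim (middle hnm D) (middle hnm D')]
        exact Indist.refl hε.le _
      obtain ⟨v, v', j₀, σ, σ', hv, h1, h2⟩ := exists_middle_eq_comp_perm hn hnm hi₀
      rw [h1, h2, symMech_comp_perm, symMech_comp_perm]
      refine symMech_indist hε.le hMdp (fun i => ?_) (fun i => ?_) hv
      · simpa [h1] using hmid hD (σ.symm i)
      · simpa [h2] using hmid hD' (σ'.symm i)
    rw [two_mul, two_mul]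
    exact gridMech_indist hδ.le hδ.le hμ hP hi₀ K
  · intro D hD
    rw [two_mul]
    refine gridMech_le hβ.le hβ.le (by linarith) hKN hP
      ((hMs.symMech (middle hnm D) (hmid hD)).trans (measure_mono ?_))
    rintro cr ⟨hcount, hr⟩
    obtain ⟨j, hj₁, hj₂⟩ := exists_mem_of_intervalCount_pos
      (Nat.cast_pos.1 (hΔt'.trans_le hcount))
    obtain ⟨i, hi, j₁, j₂, h1, h2⟩ :=
      exists_grid_between (hmid hD) htn hKw (by linarith) hj₁ hj₂ hr
    refine ⟨i, ?_⟩
    have h3 := lt_rankScore_of_middle hnm D h1 h2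
    have h4 : m ≤ n + 2 * rankScore D (grid K cr i) := by omega
    rw [gridScore, if_pos hi]
    rify at h4
    linarith
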